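/- Let S ⊆ ℝ² be a finite set whose convex hull P = convexHull ℝ S has nonempty interior. Then there exists a parallelogram G with P ⊆ G whose area is minimal among all parallelograms containing P, and such that at least one of the two sides of G in the pair {a, c} contains two distinct points of P, and at least one of the two sides of G in the pair {b, d} contains two distinct points of P (i.e., two adjacent sides of G each touch P along an edge). -/

import Mathlib

open MeasureTheory

/-- The parallelogram with center `z` and spanning vectors `v`, `w`:
the set `{z + s•v + t•w : s, t ∈ [−1, 1]}`. -/
def Pgram (z v w : ℝ × ℝ) : Set (ℝ × ℝ) :=
  {x | ∃ s t : ℝ, s ∈ Set.Icc (-1 : ℝ) 1 ∧ t ∈ Set.Icc (-1 : ℝ) 1 ∧ x = z + s • v + t • w}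

/-- Side `a` of the parallelogram. -/
def sideA (z v w : ℝ × ℝ) : Set (ℝ × ℝ) := segment ℝ (z - v - w) (z - v + w)

/-- Side `b` of the parallelogram. -/
def sideB (z v w : ℝ × ℝ) : Set (ℝ × ℝ) := segment ℝ (z - v + w) (z + v + w)

/-- Side `c` of the parallelogram. -/
def sideC (z v w : ℝ × ℝ) : Set (ℝ × ℝ) := segment ℝ (z + v - w) (z + v + w)

/-- Side `d` of the parallelogram. -/
def sideD (z v w : ℝ × ℝ) : Set (ℝ × ℝ) := segment ℝ (z - v - w) (z + v - w)


namespace PgramAux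

/-- The pairing of a covector with a vector. -/
def pr (f x : ℝ × ℝ) : ℝ := f.1 * x.1 + f.2 * x.2

/-- The determinant. -/
def dt (f g : ℝ × ℝ) : ℝ := f.1 * g.2 - f.2 * g.1

/-- Covectors for which `S` has width at most two. -/
def K (S : Set (ℝ × ℝ)) : Set (ℝ × ℝ) := {f | ∀ p ∈ S, ∀ q ∈ S, pr f p - pr f q ≤ 2}

lemma pgram_volume (z v w : ℝ × ℝ) :
    volume (Pgram z v w) = ENNReal.ofReal |dt v w| * volume (Set.Icc (-1 : ℝ) 1 ×ˢ Set.Icc (-1 : ℝ) 1) := by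
  have h : Pgram z v w = (fun x => z + x) ''
      ((Matrix.toLin (Module.Basis.finTwoProd ℝ) (Module.Basis.finTwoProd ℝ) !![v.1, w.1; v.2, w.2]) ''
        (Set.Icc (-1 : ℝ) 1 ×ˢ Set.Icc (-1 : ℝ) 1)) := by
    ext x
    rw [Matrix.toLin_finTwoProd]
    simp only [Pgram, Set.mem_ofPred_eq, Set.mem_image, Set.mem_prod]
    constructor
    · rintro ⟨s, t, hs, ht, rfl⟩
      refine ⟨s • v + t • w, ⟨(s, t), ⟨hs, ht⟩, ?_⟩, by rw [add_assoc]⟩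
      ext <;> simp <;> ring
    · rintro ⟨_, ⟨⟨s, t⟩, ⟨hs, ht⟩, rfl⟩, rfl⟩
      refine ⟨s, t, hs, ht, ?_⟩
      ext <;> simp <;> ring
  rw [h, Set.image_add_left, measure_preimage_add, Measure.addHaar_image_linearMap,
    LinearMap.det_toLin, Matrix.det_fin_two_of]
  congr 3
  unfold dt; ring

lemma K_hull {S : Set (ℝ × ℝ)} {f : ℝ × ℝ} (hf : f ∈ K S) {x y : ℝ × ℝ}
    (hx : x ∈ convexHull ℝ S) (hy : y ∈ convexHull ℝ S) : pr f x - pr f y ≤ 2 := by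
  have lin : IsLinearMap ℝ (pr f) := ⟨fun a b => by simp [pr]; ring, fun a b => by simp [pr]; ring⟩
  have h1 : ∀ q ∈ S, ∀ x ∈ convexHull ℝ S, pr f x - pr f q ≤ 2 := by
    intro q hq x hx
    have : convexHull ℝ S ⊆ {x | pr f x ≤ 2 + pr f q} :=
      convexHull_min (fun p hp => by have := hf p hp q hq; simp only [Set.mem_ofPred_eq]; linarith)
        (convex_halfSpace_le lin _)
    have := this hx
    simp only [Set.mem_ofPred_eq] at this; linarith
  have : convexHull ℝ S ⊆ {y | pr f x - 2 ≤ pr f y} :=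
    convexHull_min (fun q hq => by have := h1 q hq x hx; simp only [Set.mem_ofPred_eq]; linarith)
      (convex_halfSpace_ge lin _)
  have := this hy
  simp only [Set.mem_ofPred_eq] at this; linarith

lemma K_closed (S : Set (ℝ × ℝ)) : IsClosed (K S) := by
  have : K S = ⋂ p ∈ S, ⋂ q ∈ S, {f | pr f p - pr f q ≤ 2} := by
    ext; simp [K]
  rw [this]
  refine isClosed_biInter fun p _ => isClosed_biInter fun q _ => isClosed_le ?_ continuous_const
  unfold pr; fun_prop

lemma K_compact {S : Set (ℝ × ℝ)} (hint : (interior (convexHull ℝ S)).Nonempty) :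
    IsCompact (K S) := by
  obtain ⟨x, hx⟩ := hint
  obtain ⟨r, hr, hb⟩ := Metric.isOpen_iff.1 isOpen_interior x hx
  have key : ∀ u : ℝ × ℝ, ‖u‖ < r → x + u ∈ convexHull ℝ S := fun u hu =>
    interior_subset (hb (by simpa [mem_ball_iff_norm] using hu))
  have hx' := interior_subset hx
  have hr2 : |r / 2| < r := by rw [abs_of_pos (by linarith)]; linarith
  have hr3 : |-(r / 2)| < r := by rw [abs_neg]; exact hr2
  have k1 := key (r/2, 0) (by simp only [Prod.norm_mk, Real.norm_eq_abs]; simp only [abs_zero]; exact max_lt hr2 hr)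
  have k2 := key (-(r/2), 0) (by simp only [Prod.norm_mk, Real.norm_eq_abs]; simp only [abs_zero]; exact max_lt hr3 hr)
  have k3 := key (0, r/2) (by simp only [Prod.norm_mk, Real.norm_eq_abs]; simp only [abs_zero]; exact max_lt hr hr2)
  have k4 := key (0, -(r/2)) (by simp only [Prod.norm_mk, Real.norm_eq_abs]; simp only [abs_zero]; exact max_lt hr hr3)
  refine (isCompact_Icc (a := ((-(4/r), -(4/r)) : ℝ × ℝ)) (b := (4/r, 4/r))).of_isClosed_subset
    (K_closed S) ?_
  intro f hf
  have a1 := K_hull hf k1 hx'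
  have a2 := K_hull hf k2 hx'
  have a3 := K_hull hf k3 hx'
  have a4 := K_hull hf k4 hx'
  simp only [pr, Prod.fst_add, Prod.snd_add] at a1 a2 a3 a4
  have b : ∀ t : ℝ, t * (r / 2) ≤ 2 → t ≤ 4 / r := fun t ht => by
    rw [le_div_iff₀ hr]; linarith
  refine ⟨⟨?_, ?_⟩, ⟨?_, ?_⟩⟩
  · have := b (-f.1) (by linarith); simp only; linarith
  · have := b (-f.2) (by linarith); simp only; linarith
  · exact b _ (by linarith)
  · exact b _ (by linarith)

lemma exists_small {S : Set (ℝ × ℝ)} (hS : S.Finite) (f u : ℝ × ℝ)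
    (h : ∀ p ∈ S, ∀ q ∈ S, pr f p - pr f q < 2 ∨ (pr f p - pr f q ≤ 2 ∧ pr u p - pr u q = 0)) :
    ∃ ε : ℝ, ε > 0 ∧ f + ε • u ∈ K S ∧ f - ε • u ∈ K S := by
  have : ∀ᶠ ε : ℝ in nhdsWithin 0 (Set.Ioi 0), ∀ x ∈ S ×ˢ S,
      pr (f + ε • u) x.1 - pr (f + ε • u) x.2 ≤ 2 ∧ pr (f - ε • u) x.1 - pr (f - ε • u) x.2 ≤ 2 := by
    rw [Filter.eventually_all_finite (hS.prod hS)]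
    rintro ⟨p, q⟩ ⟨hp, hq⟩
    rcases h p hp q hq with h | ⟨h, h0⟩
    · have c1 : Continuous fun ε : ℝ => pr (f + ε • u) p - pr (f + ε • u) q := by
        unfold pr; fun_prop
      have c2 : Continuous fun ε : ℝ => pr (f - ε • u) p - pr (f - ε • u) q := by
        unfold pr; fun_prop
      have e1 := (c1.tendsto 0).eventually (eventually_lt_nhds (b := 2) (by simpa using h))
      have e2 := (c2.tendsto 0).eventually (eventually_lt_nhds (b := 2) (by simpa using h))
      filter_upwards [nhdsWithin_le_nhds e1, nhdsWithin_le_nhds e2] with ε h1 h2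
      exact ⟨h1.le, h2.le⟩
    · refine Filter.Eventually.of_forall fun ε => ?_
      simp only [pr, Prod.fst_add, Prod.snd_add, Prod.fst_sub, Prod.snd_sub, Prod.smul_fst,
        Prod.smul_snd, smul_eq_mul] at *
      have e : ε * (u.1 * p.1 + u.2 * p.2 - (u.1 * q.1 + u.2 * q.2)) = 0 := by rw [h0, mul_zero]
      constructor <;> linarith
  obtain ⟨ε, h1, h2⟩ := (this.and self_mem_nhdsWithin).exists
  exact ⟨ε, h2, fun p hp q hq => (h1 (p, q) ⟨hp, hq⟩).1, fun p hp q hq => (h1 (p, q) ⟨hp, hq⟩).2⟩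

/-- Extreme covectors have two distinct active constraints. -/
lemma extreme_two {S : Set (ℝ × ℝ)} (hS : S.Finite) {f : ℝ × ℝ}
    (hf : f ∈ (K S).extremePoints ℝ) :
    ∃ p₁ ∈ S, ∃ q₁ ∈ S, ∃ p₂ ∈ S, ∃ q₂ ∈ S, pr f p₁ - pr f q₁ = 2 ∧ pr f p₂ - pr f q₂ = 2 ∧
      (p₁ ≠ p₂ ∨ q₁ ≠ q₂) := by
  by_contra! hcon
  have hu : ∃ u : ℝ × ℝ, u ≠ 0 ∧ ∀ p ∈ S, ∀ q ∈ S, pr f p - pr f q = 2 → pr u p - pr u q = 0 := by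
    by_cases hex : ∃ p ∈ S, ∃ q ∈ S, pr f p - pr f q = 2
    · obtain ⟨p, hp, q, hq, hpq⟩ := hex
      refine ⟨(p.2 - q.2, -(p.1 - q.1)), ?_, ?_⟩
      · intro h
        simp only [Prod.mk_eq_zero] at h
        have h1 : p.2 = q.2 := by linarith
        have h2 : p.1 = q.1 := by linarith
        simp only [pr, h1, h2] at hpq
        linarith
      · intro p' hp' q' hq' h
        obtain ⟨rfl, rfl⟩ := hcon p hp q hq p' hp' q' hq' hpq h
        simp only [pr]; ring
    · push Not at hex
      exact ⟨(1, 0), by simp, fun p hp q hq h => absurd h (hex p hp q hq)⟩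
  obtain ⟨u, hu0, hu⟩ := hu
  obtain ⟨ε, hε, h1, h2⟩ := exists_small hS f u (fun p hp q hq => by
    have := hf.1 p hp q hq
    rcases this.lt_or_eq with h | h
    · exact Or.inl h
    · exact Or.inr ⟨this, hu p hp q hq h⟩)
  have := hf.2 h1 h2 ⟨1/2, 1/2, by norm_num, by norm_num, by norm_num, by
    ext <;> simp <;> ring⟩
  have h3 : ε • u = 0 := by simpa using this
  rcases smul_eq_zero.1 h3 with h | h
  · exact hε.ne' h
  · exact hu0 h

/-- A linear functional on `K` is maximized at an extreme point. -/
lemma max_extreme {A : Set (ℝ × ℝ)} (hA : IsCompact A) (hne : A.Nonempty) (c : ℝ × ℝ) :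
    ∃ f ∈ A.extremePoints ℝ, ∀ f' ∈ A, pr c f' ≤ pr c f := by
  have hc : Continuous (pr c) := by unfold pr; fun_prop
  obtain ⟨f0, hf0, hmax⟩ := hA.exists_isMaxOn hne hc.continuousOn
  have hmax' : ∀ f ∈ A, pr c f ≤ pr c f0 := fun f hf => hmax hf
  have hB : IsCompact (A ∩ {f | pr c f0 ≤ pr c f}) :=
    hA.inter_right (isClosed_le continuous_const hc)
  obtain ⟨f, hf⟩ := hB.extremePoints_nonempty ⟨f0, hf0, le_refl (pr c f0)⟩
  refine ⟨f, ⟨hf.1.1, ?_⟩, fun f' hf' => (hmax' f' hf').trans hf.1.2⟩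
  rintro x hx y hy ⟨a, b, ha, hb, hab, rfl⟩
  have hle : pr c f0 ≤ pr c (a • x + b • y) := hf.1.2
  have e : pr c (a • x + b • y) = a * pr c x + b * pr c y := by simp [pr]; ring
  rw [e] at hle
  have hx' := hmax' x hx
  have hy' := hmax' y hy
  have e2 : pr c f0 = a * pr c f0 + b * pr c f0 := by rw [← add_mul, hab, one_mul]
  refine hf.2 ⟨hx, ?_⟩ ⟨hy, ?_⟩ ⟨a, b, ha, hb, hab, rfl⟩
  · by_contra hlt
    simp only [Set.mem_ofPred_eq, not_le] at hlt
    nlinarith [mul_lt_mul_of_pos_left hlt ha, mul_le_mul_of_nonneg_left hy' hb.le]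
  · by_contra hlt
    simp only [Set.mem_ofPred_eq, not_le] at hlt
    nlinarith [mul_lt_mul_of_pos_left hlt hb, mul_le_mul_of_nonneg_left hx' ha.le]

lemma exists_max {S : Set (ℝ × ℝ)} (hS : S.Finite)
    (hint : (interior (convexHull ℝ S)).Nonempty) :
    ∃ f ∈ (K S).extremePoints ℝ, ∃ g ∈ (K S).extremePoints ℝ,
      0 < dt f g ∧ ∀ f' ∈ K S, ∀ g' ∈ K S, dt f' g' ≤ dt f g := by
  have hK := K_compact hint
  have h0 : (0 : ℝ × ℝ) ∈ K S := fun p _ q _ => by simp [pr]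
  have hcont : Continuous fun x : (ℝ × ℝ) × (ℝ × ℝ) => dt x.1 x.2 := by unfold dt; fun_prop
  obtain ⟨⟨f0, g0⟩, ⟨hf0, hg0⟩, hmax⟩ := (hK.prod hK).exists_isMaxOn ⟨(0, 0), h0, h0⟩ hcont.continuousOn
  have hmax' : ∀ f ∈ K S, ∀ g ∈ K S, dt f g ≤ dt f0 g0 := fun f hf g hg =>
    hmax (show (f, g) ∈ K S ×ˢ K S from ⟨hf, hg⟩)
  obtain ⟨f, hf, hfm⟩ := max_extreme hK ⟨0, h0⟩ (g0.2, -g0.1)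
  obtain ⟨g, hg, hgm⟩ := max_extreme hK ⟨0, h0⟩ (-f.2, f.1)
  have hge : dt f0 g0 ≤ dt f g := by
    have h1 := hfm f0 hf0
    have h2 := hgm g0 hg0
    simp only [pr, dt] at *
    linarith
  obtain ⟨a, ha, ha1, -⟩ := exists_small hS 0 (1, 0) (fun p _ q _ => Or.inl (by simp [pr]))
  obtain ⟨b, hb, hb1, -⟩ := exists_small hS 0 (0, 1) (fun p _ q _ => Or.inl (by simp [pr]))
  refine ⟨f, hf, g, hg, ?_, fun f' hf' g' hg' => (hmax' f' hf' g' hg').trans hge⟩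
  have := (hmax' _ ha1 _ hb1).trans hge
  refine lt_of_lt_of_le ?_ this
  simp only [dt, Prod.fst_add, Prod.snd_add, Prod.smul_fst, Prod.smul_snd, smul_eq_mul, Prod.fst_zero, Prod.snd_zero]
  have := mul_pos ha hb
  simpa using this

lemma dt_ne {v w : ℝ × ℝ} : LinearIndependent ℝ ![v, w] ↔ dt v w ≠ 0 := by
  rw [LinearIndependent.pair_iff]
  constructor
  · intro h h0
    unfold dt at h0
    have h1 := h w.2 (-v.2) (by ext <;> simp <;> linarith)
    have h2 := h w.1 (-v.1) (by ext <;> simp <;> linarith)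
    have := h 1 0 (by ext <;> simp <;> linarith)
    simp at this
  · intro h s t hst
    have e1 : s * v.1 + t * w.1 = 0 := by simpa using congrArg Prod.fst hst
    have e2 : s * v.2 + t * w.2 = 0 := by simpa using congrArg Prod.snd hst
    unfold dt at h
    constructor
    · refine (mul_eq_zero.1 (?_ : s * (v.1 * w.2 - v.2 * w.1) = 0)).resolve_right h
      linear_combination w.2 * e1 - w.1 * e2
    · refine (mul_eq_zero.1 (?_ : t * (v.1 * w.2 - v.2 * w.1) = 0)).resolve_right h
      linear_combination v.1 * e2 - v.2 * e1

/-- The dual covectors of an enclosing parallelogram lie in `K`. -/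
lemma dual_mem {S : Set (ℝ × ℝ)} {z v w : ℝ × ℝ} (h : dt v w ≠ 0) (hs : S ⊆ Pgram z v w) :
    (w.2 / dt v w, -w.1 / dt v w) ∈ K S ∧ (-v.2 / dt v w, v.1 / dt v w) ∈ K S := by
  constructor
  · intro p hp q hq
    obtain ⟨s, t, hs1, -, rfl⟩ := hs hp
    obtain ⟨s', t', hs2, -, rfl⟩ := hs hq
    have : pr (w.2 / dt v w, -w.1 / dt v w) (z + s • v + t • w)
      - pr (w.2 / dt v w, -w.1 / dt v w) (z + s' • v + t' • w) = s - s' := by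
      simp only [pr, Prod.fst_add, Prod.snd_add, Prod.smul_fst, Prod.smul_snd, smul_eq_mul]
      field_simp
      unfold dt; ring
    rw [this]; linarith [hs1.2, hs2.1]
  · intro p hp q hq
    obtain ⟨s, t, -, hs1, rfl⟩ := hs hp
    obtain ⟨s', t', -, hs2, rfl⟩ := hs hq
    have : pr (-v.2 / dt v w, v.1 / dt v w) (z + s • v + t • w)
      - pr (-v.2 / dt v w, v.1 / dt v w) (z + s' • v + t' • w) = t - t' := by
      simp only [pr, Prod.fst_add, Prod.snd_add, Prod.smul_fst, Prod.smul_snd, smul_eq_mul]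
      field_simp
      unfold dt; ring
    rw [this]; linarith [hs1.2, hs2.1]

lemma mem_seg (z u w : ℝ × ℝ) {t : ℝ} (ht : t ∈ Set.Icc (-1 : ℝ) 1) :
    z + u + t • w ∈ segment ℝ (z + u - w) (z + u + w) :=
  ⟨(1 - t) / 2, (1 + t) / 2, by linarith [ht.2], by linarith [ht.1], by ring, by
    ext <;> simp <;> ring⟩

lemma pgram_convex (z v w : ℝ × ℝ) : Convex ℝ (Pgram z v w) := by
  rintro _ ⟨s, t, hs, ht, rfl⟩ _ ⟨s', t', hs', ht', rfl⟩ a b ha hb hab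
  have h1 := convex_Icc (-1 : ℝ) 1 hs hs' ha hb hab
  have h2 := convex_Icc (-1 : ℝ) 1 ht ht' ha hb hab
  refine ⟨_, _, h1, h2, ?_⟩
  obtain rfl : b = 1 - a := by linarith
  ext <;> simp <;> ring

end PgramAux

open PgramAux in
/-- There is a smallest parallelogram enclosing the convex hull `P` of a finite
set (with nonempty interior) such that at least one of the sides `a`, `c` contains two
distinct points of `P`, and at least one of the sides `b`, `d` contains two distinct points
of `P`. -/
theorem exists_smallest_enclosing_parallelogram_two_flush
    (S : Set (ℝ × ℝ)) (hS : S.Finite)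
    (hint : (interior (convexHull ℝ S)).Nonempty) :
    ∃ z v w : ℝ × ℝ, LinearIndependent ℝ ![v, w] ∧
      convexHull ℝ S ⊆ Pgram z v w ∧
      (∀ z' v' w' : ℝ × ℝ, LinearIndependent ℝ ![v', w'] →
        convexHull ℝ S ⊆ Pgram z' v' w' →
        volume (Pgram z v w) ≤ volume (Pgram z' v' w')) ∧
      ((∃ p q : ℝ × ℝ, p ∈ convexHull ℝ S ∧ q ∈ convexHull ℝ S ∧ p ≠ q ∧
          p ∈ sideA z v w ∧ q ∈ sideA z v w) ∨
       (∃ p q : ℝ × ℝ, p ∈ convexHull ℝ S ∧ q ∈ convexHull ℝ S ∧ p ≠ q ∧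
          p ∈ sideC z v w ∧ q ∈ sideC z v w)) ∧
      ((∃ p q : ℝ × ℝ, p ∈ convexHull ℝ S ∧ q ∈ convexHull ℝ S ∧ p ≠ q ∧
          p ∈ sideB z v w ∧ q ∈ sideB z v w) ∨
       (∃ p q : ℝ × ℝ, p ∈ convexHull ℝ S ∧ q ∈ convexHull ℝ S ∧ p ≠ q ∧
          p ∈ sideD z v w ∧ q ∈ sideD z v w)) := by
  obtain ⟨f, hf, g, hg, hD, hmax⟩ := exists_max hS hint
  obtain ⟨p₁, hp₁, q₁, hq₁, p₂, hp₂, q₂, hq₂, h1, h2, hne⟩ := extreme_two hS hf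
  obtain ⟨p₃, hp₃, q₃, hq₃, p₄, hp₄, q₄, hq₄, h3, h4, hne'⟩ := extreme_two hS hg
  have hDne : f.1 * g.2 - f.2 * g.1 ≠ 0 := hD.ne'
  obtain ⟨D, hDdef⟩ : ∃ D, D = dt f g := ⟨_, rfl⟩
  have hD0 : D ≠ 0 := by rw [hDdef]; exact hD.ne'
  have hDpos : 0 < D := by rw [hDdef]; exact hD
  obtain ⟨v, hv⟩ : ∃ v : ℝ × ℝ, v = (g.2 / D, -g.1 / D) := ⟨_, rfl⟩
  obtain ⟨w, hw⟩ : ∃ w : ℝ × ℝ, w = (-f.2 / D, f.1 / D) := ⟨_, rfl⟩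
  obtain ⟨a, ha⟩ : ∃ a, a = (pr f p₁ + pr f q₁) / 2 := ⟨_, rfl⟩
  obtain ⟨b, hb⟩ : ∃ b, b = (pr g p₃ + pr g q₃) / 2 := ⟨_, rfl⟩
  obtain ⟨z, hz⟩ : ∃ z : ℝ × ℝ, z = a • v + b • w := ⟨_, rfl⟩
  have hvw : dt v w = 1 / D := by
    rw [hv, hw]
    simp only [dt] at hDdef ⊢
    field_simp
    rw [hDdef]; ring
  have rep : ∀ x : ℝ × ℝ, x = z + (pr f x - a) • v + (pr g x - b) • w := by
    intro x
    have : x = pr f x • v + pr g x • w := by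
      rw [hv, hw]
      simp only [dt] at hDdef
      ext
      · simp only [pr, Prod.fst_add, Prod.smul_fst, smul_eq_mul]
        field_simp
        rw [hDdef]; ring
      · simp only [pr, Prod.snd_add, Prod.smul_snd, smul_eq_mul]
        field_simp
        rw [hDdef]; ring
    rw [hz]
    calc x = pr f x • v + pr g x • w := this
      _ = _ := by module
  have bf : ∀ x ∈ S, pr f x - a ∈ Set.Icc (-1 : ℝ) 1 := fun x hx => by
    have e1 := hf.1 x hx q₁ hq₁
    have e2 := hf.1 p₁ hp₁ x hx
    constructor <;> linarith
  have bg : ∀ x ∈ S, pr g x - b ∈ Set.Icc (-1 : ℝ) 1 := fun x hx => by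
    have e1 := hg.1 x hx q₃ hq₃
    have e2 := hg.1 p₃ hp₃ x hx
    constructor <;> linarith
  have hsub := subset_convexHull ℝ S
  have onA : ∀ x ∈ S, pr f x - a = -1 → x ∈ sideA z v w := fun x hx h => by
    have := mem_seg z (-v) w (bg x hx)
    have e := rep x
    rw [h, neg_one_smul] at e
    rw [← e] at this
    simpa only [sideA, sub_eq_add_neg] using this
  have onC : ∀ x ∈ S, pr f x - a = 1 → x ∈ sideC z v w := fun x hx h => by
    have := mem_seg z v w (bg x hx)
    have e := rep x
    rw [h, one_smul] at e
    rw [← e] at this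
    exact this
  have onD : ∀ x ∈ S, pr g x - b = -1 → x ∈ sideD z v w := fun x hx h => by
    have := mem_seg z (-w) v (bf x hx)
    have e := rep x
    rw [h, neg_one_smul, add_right_comm] at e
    rw [← e] at this
    unfold sideD
    convert this using 2 <;> abel
  have onB : ∀ x ∈ S, pr g x - b = 1 → x ∈ sideB z v w := fun x hx h => by
    have := mem_seg z w v (bf x hx)
    have e := rep x
    rw [h, one_smul, add_right_comm] at e
    rw [← e] at this
    unfold sideB
    convert this using 2 <;> abel
  refine ⟨z, v, w, ?_, ?_, ?_, ?_, ?_⟩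
  · rw [dt_ne, hvw]; positivity
  · exact convexHull_min (fun x hx => ⟨_, _, bf x hx, bg x hx, rep x⟩) (pgram_convex z v w)
  · intro z' v' w' hli hP
    rw [dt_ne] at hli
    obtain ⟨m1, m2⟩ := dual_mem hli (hsub.trans hP)
    have k1 := hmax _ m1 _ m2
    have k2 := hmax _ m2 _ m1
    have e1 : dt (w'.2 / dt v' w', -w'.1 / dt v' w') (-v'.2 / dt v' w', v'.1 / dt v' w')
        = 1 / dt v' w' := by
      generalize hE : dt v' w' = E at *
      simp only [dt] at hE ⊢
      field_simp
      rw [← hE]; ring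
    have e2 : dt (-v'.2 / dt v' w', v'.1 / dt v' w') (w'.2 / dt v' w', -w'.1 / dt v' w')
        = -(1 / dt v' w') := by
      rw [← e1]; simp only [dt]; ring
    rw [e1, ← hDdef] at k1
    rw [e2, ← hDdef] at k2
    have k3 : |1 / dt v' w'| ≤ D := abs_le.2 ⟨by linarith, k1⟩
    rw [pgram_volume, pgram_volume]
    suffices hle : |dt v w| ≤ |dt v' w'| by gcongr
    rw [hvw, abs_of_pos (by positivity)]
    rw [abs_div, abs_one] at k3
    exact (one_div_le (abs_pos.2 hli) hDpos).1 k3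
  · have i1 := hf.1 p₁ hp₁ q₂ hq₂
    have i2 := hf.1 p₂ hp₂ q₁ hq₁
    rcases hne with hne | hne
    · exact Or.inr ⟨p₁, p₂, hsub hp₁, hsub hp₂, hne, onC _ hp₁ (by linarith), onC _ hp₂ (by linarith)⟩
    · exact Or.inl ⟨q₁, q₂, hsub hq₁, hsub hq₂, hne, onA _ hq₁ (by linarith), onA _ hq₂ (by linarith)⟩
  · have i1 := hg.1 p₃ hp₃ q₄ hq₄
    have i2 := hg.1 p₄ hp₄ q₃ hq₃
    rcases hne' with hne | hne
    · exact Or.inl ⟨p₃, p₄, hsub hp₃, hsub hp₄, hne, onB _ hp₃ (by linarith), onB _ hp₄ (by linarith)⟩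
    · exact Or.inr ⟨q₃, q₄, hsub hq₃, hsub hq₄, hne, onD _ hq₃ (by linarith), onD _ hq₄ (by linarith)⟩
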